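/- For every prime number p, the modular polynomial satisfies the Kronecker congruence J_p(X,Y) ≡ (X^p − Y)(X − Y^p) mod p; that is, every coefficient of J_p(X,Y) − (X^p − Y)(X − Y^p) ∈ ℤ[X,Y] is divisible by p. -/

import Mathlib

open Polynomial Complex IntermediateField

noncomputable section

/-- 2×2 integer matrices. -/
abbrev Mat : Type := Matrix (Fin 2) (Fin 2) ℤ

/-- The modular group SL₂(ℤ). -/
abbrev SL2Z := Matrix.SpecialLinearGroup (Fin 2) ℤ

/-- A 2×2 integer matrix is primitive if the gcd of its four entries is 1. -/
def Mat.IsPrimitive (S : Mat) : Prop :=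
  Nat.gcd (Nat.gcd (S 0 0).natAbs (S 0 1).natAbs)
    (Nat.gcd (S 1 0).natAbs (S 1 1).natAbs) = 1

/-- Left equivalence of matrices under SL₂(ℤ). -/
def LeftEquiv (S T : Mat) : Prop := ∃ M : SL2Z, S = (M : Mat) * T

/-- Möbius action of an integer matrix on a complex number. -/
def moeb (S : Mat) (z : ℂ) : ℂ :=
  ((S 0 0 : ℂ) * z + (S 0 1 : ℂ)) / ((S 1 0 : ℂ) * z + (S 1 1 : ℂ))

/-- ψ(s) = s·∏_{p∣s}(1+1/p) = Σ_{d∣s squarefree} s/d. -/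
def psi (s : ℕ) : ℕ := ∑ d ∈ s.divisors, if Squarefree d then s / d else 0

/-- Eisenstein series g₂. -/
def g2C (z : ℂ) : ℂ :=
  60 * ∑' w : {v : ℤ × ℤ // v ≠ 0}, ((w.1.1 : ℂ) * z + (w.1.2 : ℂ)) ^ (-4 : ℤ)

/-- Eisenstein series g₃. -/
def g3C (z : ℂ) : ℂ :=
  140 * ∑' w : {v : ℤ × ℤ // v ≠ 0}, ((w.1.1 : ℂ) * z + (w.1.2 : ℂ)) ^ (-6 : ℤ)

/-- The discriminant Δ. -/
def discC (z : ℂ) : ℂ := g2C z ^ 3 - 27 * g3C z ^ 2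

/-- The modular invariant j. -/
def jC (z : ℂ) : ℂ := 1728 * g2C z ^ 3 / discC z

/-- A family of matrices is a complete system of representatives of the left SL₂(ℤ)-orbits
of primitive integer matrices of determinant `s`. -/
def IsOrbitReps (s : ℕ) {n : ℕ} (R : Fin n → Mat) : Prop :=
  (∀ ν, (R ν).IsPrimitive ∧ (R ν).det = (s : ℤ)) ∧
  ∀ T : Mat, T.IsPrimitive → T.det = (s : ℤ) → ∃! ν, LeftEquiv T (R ν)

/-- Evaluation of an integer polynomial at j(z). -/
def evalAtJ (z : ℂ) : Polynomial ℤ →+* ℂ := eval₂RingHom (Int.castRingHom ℂ) (jC z)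

/-- J is the modular polynomial of level s: an element of ℤ[Y][X], monic in X of degree ψ(s),
such that J(X, j(ω)) = ∏_ν (X − j(S_ν ω)) for every ω in the upper half-plane. -/
def IsModularPoly (s : ℕ) (J : Polynomial (Polynomial ℤ)) : Prop :=
  J.Monic ∧ J.natDegree = psi s ∧
  ∀ R : Fin (psi s) → Mat, IsOrbitReps s R → ∀ z : ℂ, 0 < z.im →
    J.map (evalAtJ z) = ∏ ν, (X - C (jC (moeb (R ν) z)))

/-- The one-variable polynomial J(X,X) obtained by setting Y = X. -/
def diagPoly (J : Polynomial (Polynomial ℤ)) : Polynomial ℤ := J.eval Polynomial.X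

/-- φ_S(ω) = s¹²·Δ(Sω)/((cω+d)¹²·Δ(ω)). -/
def phiS (S : Mat) (z : ℂ) : ℂ :=
  (S.det : ℂ) ^ 12 * discC (moeb S z) /
    (((S 1 0 : ℂ) * z + (S 1 1 : ℂ)) ^ 12 * discC z)

/-- K is an imaginary quadratic subfield of ℂ. -/
def IsImagQuad (K : Subfield ℂ) : Prop :=
  ∃ θ : ℂ, 0 < θ.im ∧ Module.finrank ℚ ℚ⟮θ⟯ = 2 ∧ K = ℚ⟮θ⟯.toSubfield

/-- O is an order of the field K: a subring of K which is a finitely generated additive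
group containing a ℚ-basis of K. -/
structure IsOrder (K : Subfield ℂ) (O : Subring ℂ) : Prop where
  le : (O : Set ℂ) ⊆ (K : Set ℂ)
  fg : O.toAddSubgroup.FG
  full : ∀ x ∈ K, ∃ n : ℤ, n ≠ 0 ∧ (n : ℂ) * x ∈ O

/-- The lattice spanned by a and b. -/
def zLat (a b : ℂ) : AddSubgroup ℂ := AddSubgroup.closure {a, b}

/-- (a,b) is a ℤ-basis (with Im(a/b) > 0) of a proper (characteristic) ideal of the
order O of K: the lattice ℤa+ℤb lies in K and its multiplier ring is exactly O. -/
def IsIdealBasis (K : Subfield ℂ) (O : Subring ℂ) (a b : ℂ) : Prop :=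
  0 < (a / b).im ∧ a ∈ K ∧ b ∈ K ∧
  ∀ lam : ℂ, lam ∈ O ↔ (lam * a ∈ zLat a b ∧ lam * b ∈ zLat a b)

/-- Two lattices differ by a nonzero scalar factor. -/
def LatEquiv (A B : AddSubgroup ℂ) : Prop :=
  ∃ μ : ℂ, μ ≠ 0 ∧ (B : Set ℂ) = (fun z => μ * z) '' (A : Set ℂ)

/-- The two ideals with the given bases lie in the same ideal class. -/
def IdealEquiv (a b a' b' : ℂ) : Prop := LatEquiv (zLat a b) (zLat a' b')

/-- Product of two lattices. -/
def latMul (A B : AddSubgroup ℂ) : AddSubgroup ℂ :=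
  AddSubgroup.closure {z : ℂ | ∃ x ∈ A, ∃ y ∈ B, z = x * y}

/-- μ is a primitive element of the order O : μ ∈ O and μ/t ∉ O for every integer t > 1. -/
def IsPrimElem (O : Subring ℂ) (μ : ℂ) : Prop :=
  μ ∈ O ∧ ∀ t : ℤ, 1 < t → μ / (t : ℂ) ∉ O

/-- μ and μ' are associated in O (differ by a unit of O). -/
def UnitAssoc (O : Subring ℂ) (μ μ' : ℂ) : Prop :=
  ∃ ε : ℂ, ε ∈ O ∧ ε ≠ 0 ∧ ε⁻¹ ∈ O ∧ μ' = ε * μ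

/-- The ring of integers of a subfield K of ℂ, as a subring of ℂ. -/
def OK (K : Subfield ℂ) : Subring ℂ := (integralClosure ℤ ℂ).toSubring ⊓ K.toSubring

/-- The index of an order O in the maximal order of K (for a quadratic field this
equals the conductor f of O). -/
def condIndex (K : Subfield ℂ) (O : Subring ℂ) : ℕ :=
  (O.toAddSubgroup.addSubgroupOf (OK K).toAddSubgroup).index

/-- The lattice in ℂ attached to an ideal of the maximal order of K. -/
def idealLat (K : Subfield ℂ) (I : Ideal ↥(OK K)) : AddSubgroup ℂ :=
  AddSubgroup.closure {z : ℂ | ∃ x ∈ I, (x : ℂ) = z}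

/-- The lattice attached to the O-ideal I ∩ O, for an ideal I of the maximal order. -/
def primeOrderLat (K : Subfield ℂ) (O : Subring ℂ) (I : Ideal ↥(OK K)) : AddSubgroup ℂ :=
  AddSubgroup.closure {z : ℂ | z ∈ O ∧ ∃ x ∈ I, (x : ℂ) = z}

/-- The set of all class invariants j(k) of ideal classes of the order O. -/
def classInvSet (K : Subfield ℂ) (O : Subring ℂ) : Set ℂ :=
  {w : ℂ | ∃ a b : ℂ, IsIdealBasis K O a b ∧ w = jC (a / b)}

/-- The ring class field Ω_R : the subfield of ℂ generated by K together with all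
class invariants of the order O. -/
def ringClassField (K : Subfield ℂ) (O : Subring ℂ) : Subfield ℂ :=
  Subfield.closure ((K : Set ℂ) ∪ classInvSet K O)

theorem le_ringClassField (K : Subfield ℂ) (O : Subring ℂ) : K ≤ ringClassField K O :=
  fun _ hx => Subfield.subset_closure (Set.mem_union_left _ hx)

noncomputable instance rcfAlgebra (K : Subfield ℂ) (O : Subring ℂ) :
    Algebra ↥K ↥(ringClassField K O) :=
  (Subfield.inclusion (le_ringClassField K O)).toAlgebra

theorem OK_mono {K L : Subfield ℂ} (h : K ≤ L) : OK K ≤ OK L := by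
  intro x hx
  rw [OK, Subring.mem_inf] at hx ⊢
  exact ⟨hx.1, h hx.2⟩

/-- 𝔭 splits completely in L/K: the extension of 𝔭 to the ring of integers of L is a
product of pairwise distinct primes, each of residue degree one over 𝔭. -/
def SplitsCompletely (K L : Subfield ℂ) (h : K ≤ L) (p : Ideal ↥(OK K)) : Prop :=
  ∃ (g : ℕ) (Q : Fin g → Ideal ↥(OK L)),
    Function.Injective Q ∧ (∀ i, (Q i).IsPrime) ∧
    Ideal.map (Subring.inclusion (OK_mono h)) p = ∏ i, Q i ∧
    ∀ i, Nat.card (↥(OK L) ⧸ Q i) = Nat.card (↥(OK K) ⧸ p)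

/-- L is a finite extension of ℚ (a number field) inside ℂ. -/
def FinDimOverQ (L : Subfield ℂ) : Prop :=
  ∃ t : Finset ℂ, (L : Set ℂ) ⊆ (Submodule.span ℚ (t : Set ℂ) : Submodule ℚ ℂ)

/-- Lattice Eisenstein sums Σ_{w∈L, w≠0} w^{-k}. -/
def gkL (k : ℕ) (L : AddSubgroup ℂ) : ℂ :=
  ∑' w : {w : ℂ // w ∈ L ∧ w ≠ 0}, (w : ℂ) ^ (-(k : ℤ))

def g2L (L : AddSubgroup ℂ) : ℂ := 60 * gkL 4 L
def g3L (L : AddSubgroup ℂ) : ℂ := 140 * gkL 6 L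
def discL (L : AddSubgroup ℂ) : ℂ := g2L L ^ 3 - 27 * g3L L ^ 2

/-- The Weierstrass ℘-function of a lattice. -/
def wpL (z : ℂ) (L : AddSubgroup ℂ) : ℂ :=
  z ^ (-2 : ℤ) + ∑' w : {w : ℂ // w ∈ L ∧ w ≠ 0},
    ((z - (w : ℂ)) ^ (-2 : ℤ) - (w : ℂ) ^ (-2 : ℤ))

/-- The Weber function τ_R(z, 𝔴), where e is the number of units of R. -/
def weber (e : ℕ) (z : ℂ) (L : AddSubgroup ℂ) : ℂ :=
  if e = 4 then 2 ^ 8 * 3 ^ 4 * (g2L L ^ 2 / discL L) * wpL z L ^ 2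
  else if e = 6 then -(2 ^ 9 * 3 ^ 6) * (g3L L / discL L) * wpL z L ^ 3
  else -(2 ^ 7 * 3 ^ 5) * (g2L L * g3L L / discL L) * wpL z L

/-- The number of units (roots of unity) in the ring of integers of K. -/
def numRootsOfUnity (K : Subfield ℂ) : ℕ :=
  Nat.card {x : ℂ // x ∈ OK K ∧ ∃ n : ℕ, 0 < n ∧ x ^ n = 1}

/-- λ ≡ 1 mod* 𝔪 (multiplicative congruence): λ = β/γ with β, γ integral and prime
to 𝔪 and β ≡ γ mod 𝔪. -/
def MulCongOne (K : Subfield ℂ) (m : Ideal ↥(OK K)) (lam : ℂ) : Prop :=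
  ∃ β γ : ↥(OK K), (γ : ℂ) ≠ 0 ∧ lam = (β : ℂ) / (γ : ℂ) ∧
    Ideal.span {β} ⊔ m = ⊤ ∧ Ideal.span {γ} ⊔ m = ⊤ ∧ β - γ ∈ m

/-- The Dedekind eta function. -/
def dedekindEta (z : ℂ) : ℂ :=
  Complex.exp (Real.pi * Complex.I * z / 12) *
    ∏' n : ℕ, (1 - Complex.exp (2 * Real.pi * Complex.I * ((n : ℂ) + 1) * z))

/-- ζ₂₄ = e^{2πi/24}. -/
def zeta24 : ℂ := Complex.exp (2 * Real.pi * Complex.I / 24)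

/-- The image of the basis (a,b) under an integer matrix. -/
def matBasis (P : Mat) (a b : ℂ) : ℂ × ℂ :=
  ((P 0 0 : ℂ) * a + (P 0 1 : ℂ) * b, (P 1 0 : ℂ) * a + (P 1 1 : ℂ) * b)

/-- The image of the basis (a,b) under a rational matrix. -/
def matBasisQ (B : Matrix (Fin 2) (Fin 2) ℚ) (a b : ℂ) : ℂ × ℂ :=
  ((B 0 0 : ℂ) * a + (B 0 1 : ℂ) * b, (B 1 0 : ℂ) * a + (B 1 1 : ℂ) * b)

/-- φ_B for a rational matrix B of positive determinant. -/
def phiQ (B : Matrix (Fin 2) (Fin 2) ℚ) (z : ℂ) : ℂ :=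
  (B.det : ℂ) ^ 12 *
      discC (((B 0 0 : ℂ) * z + (B 0 1 : ℂ)) / ((B 1 0 : ℂ) * z + (B 1 1 : ℂ))) /
    (((B 1 0 : ℂ) * z + (B 1 1 : ℂ)) ^ 12 * discC z)

/-- The lattice attached to the complex conjugate of an ideal of the maximal order. -/
def conjIdealLat (K : Subfield ℂ) (I : Ideal ↥(OK K)) : AddSubgroup ℂ :=
  AddSubgroup.closure {z : ℂ | ∃ x ∈ I, (starRingEnd ℂ) (x : ℂ) = z}

/-- The triangular representatives (a b; 0 d), a·d = s, gcd(a,b,d) = 1, 0 ≤ b < d,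
encoded as triples (a, b, d). -/
def triReps (s : ℕ) : Finset (ℕ × ℕ × ℕ) :=
  (Finset.range (s + 1) ×ˢ Finset.range (s + 1) ×ˢ Finset.range (s + 1)).filter
    (fun t => 0 < t.1 ∧ 0 < t.2.2 ∧ t.1 * t.2.2 = s ∧
      Nat.gcd t.1 (Nat.gcd t.2.1 t.2.2) = 1 ∧ t.2.1 < t.2.2)

section QExpansion

variable {A : Type*} [CommRing A] [Algebra A ℂ]

/-- `f` is given on the upper half-plane by the everywhere convergent `q`-series `P`. -/
def IsQSeries (P : PowerSeries A) (f : ℂ → ℂ) : Prop :=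
  ∀ w : ℂ, 0 < w.im →
    HasSum (fun n ↦ algebraMap A ℂ (PowerSeries.coeff n P) * cexp (2 * Real.pi * I * w) ^ n) (f w)

theorem IsQSeries.add {P Q : PowerSeries A} {f g : ℂ → ℂ} (hf : IsQSeries P f)
    (hg : IsQSeries Q g) : IsQSeries (P + Q) (f + g) := fun w hw ↦ by
  simpa [add_mul] using (hf w hw).add (hg w hw)

theorem IsQSeries.mul {P Q : PowerSeries A} {f g : ℂ → ℂ} (hf : IsQSeries P f)
    (hg : IsQSeries Q g) : IsQSeries (P * Q) (f * g) := fun w hw ↦ by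
  have hP := (hf w hw).summable.norm
  have hQ := (hg w hw).summable.norm
  have key := (summable_norm_sum_mul_antidiagonal_of_summable_norm hP hQ).of_norm.hasSum
  rw [← tsum_mul_tsum_eq_tsum_sum_antidiagonal_of_summable_norm hP hQ, (hf w hw).tsum_eq,
    (hg w hw).tsum_eq] at key
  refine key.congr_fun fun n ↦ ?_
  rw [PowerSeries.coeff_mul, map_sum, Finset.sum_mul]
  refine Finset.sum_congr rfl fun kl hkl ↦ ?_
  rw [← Finset.HasAntidiagonal.mem_antidiagonal.mp hkl, map_mul, pow_add]
  ring

theorem isQSeries_C (a : A) : IsQSeries (PowerSeries.C a) (fun _ ↦ algebraMap A ℂ a) :=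
  fun w _ ↦ by
  convert hasSum_single 0 ?_ using 1
  · simp
  · intro n hn
    simp [PowerSeries.coeff_C, hn]

variable (A) in
/-- The ring of pairs of a function and its `q`-series. -/
def qSeriesSubring : Subring ((ℂ → ℂ) × PowerSeries A) where
  carrier := {x | IsQSeries x.2 x.1}
  mul_mem' := fun ha hb ↦ IsQSeries.mul ha hb
  one_mem' := by simpa [Pi.one_def] using isQSeries_C (1 : A)
  add_mem' := fun ha hb ↦ IsQSeries.add ha hb
  zero_mem' := by simpa [Pi.zero_def] using isQSeries_C (0 : A)
  neg_mem' := fun {x} hx w hw ↦ by simpa using (hx w hw).neg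

theorem IsQSeries.pow {P : PowerSeries A} {f : ℂ → ℂ} (hf : IsQSeries P f) (n : ℕ) :
    IsQSeries (P ^ n) (f ^ n) :=
  (qSeriesSubring A).pow_mem (x := (f, P)) hf n

theorem IsQSeries.sub {P Q : PowerSeries A} {f g : ℂ → ℂ} (hf : IsQSeries P f)
    (hg : IsQSeries Q g) : IsQSeries (P - Q) (f - g) :=
  (qSeriesSubring A).sub_mem (x := (f, P)) (y := (g, Q)) hf hg

theorem IsQSeries.congr {P : PowerSeries A} {f g : ℂ → ℂ} (hf : IsQSeries P f)
    (h : ∀ w : ℂ, 0 < w.im → f w = g w) : IsQSeries P g := fun w hw ↦ h w hw ▸ hf w hw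

theorem IsQSeries.map_int {P : PowerSeries ℤ} {f : ℂ → ℂ} (hf : IsQSeries P f) :
    IsQSeries (P.map (Int.castRingHom A)) f := fun w hw ↦ by
  simpa using hf w hw

theorem IsQSeries.expand {P : PowerSeries A} {f : ℂ → ℂ} (hf : IsQSeries P f) (m : ℕ)
    (hm : m ≠ 0) : IsQSeries (P.expand m hm) (fun w ↦ f (m * w)) := fun w hw ↦ by
  have h := hf (m * w) (by simpa using mul_pos (by positivity : (0 : ℝ) < m) hw)
  have hinj : Function.Injective (fun n : ℕ ↦ m * n) := fun a b hab ↦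
    Nat.eq_of_mul_eq_mul_left (Nat.pos_of_ne_zero hm) hab
  refine (hinj.hasSum_iff ?_).mp ?_
  · intro n hn
    rw [PowerSeries.coeff_expand_of_not_dvd _ _ _ fun ⟨k, hk⟩ ↦ hn ⟨k, hk.symm⟩]
    simp
  · convert h using 2 with n
    simp only [Function.comp_apply, PowerSeries.coeff_expand_mul, ← Complex.exp_nat_mul]
    push_cast
    ring_nf

theorem IsQSeries.rescale {P : PowerSeries A} {f : ℂ → ℂ} (hf : IsQSeries P f) (c : ℝ) {ζ : A}
    (hζ : algebraMap A ℂ ζ = cexp (2 * Real.pi * I * c)) :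
    IsQSeries (PowerSeries.rescale ζ P) (fun w ↦ f (w + c)) := fun w hw ↦ by
  convert hf (w + c) (by simpa using hw) using 2 with n
  rw [PowerSeries.coeff_rescale, map_mul, map_pow, hζ, mul_add, Complex.exp_add]
  ring

theorem IsQSeries.eq_zero [FaithfulSMul A ℂ] {P : PowerSeries A} {f : ℂ → ℂ}
    (hf : IsQSeries P f) (h : ∀ w : ℂ, 0 < w.im → f w = 0) : P = 0 := by
  set c : ℕ → ℂ := fun n ↦ algebraMap A ℂ (PowerSeries.coeff n P) with hc
  have hsum (t : ℂ) (ht0 : t ≠ 0) (ht1 : ‖t‖ < 1) : HasSum (fun n ↦ c n * t ^ n) 0 := by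
    have hne : (2 * Real.pi * I : ℂ) ≠ 0 := Complex.two_pi_I_ne_zero
    set w : ℂ := Complex.log t / (2 * Real.pi * I) with hw
    have hexp : cexp (2 * Real.pi * I * w) = t := by
      rw [hw, mul_div_cancel₀ _ hne, Complex.exp_log ht0]
    have him : 0 < w.im := by
      have := hexp ▸ ht1
      rw [Complex.norm_exp, Real.exp_lt_one_iff] at this
      have h2 : (2 * Real.pi * I * w).re = -(2 * Real.pi * w.im) := by simp
      rw [h2] at this
      have := Real.pi_pos
      by_contra! hle
      nlinarith
    have := hf w him
    rwa [h w him, hexp] at this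
  let q := FormalMultilinearSeries.ofScalars ℂ c
  have hr : 0 < q.radius := by
    refine lt_of_lt_of_le ?_ (q.le_radius_of_summable (r := 1 / 2) ?_)
    · simp
    · have := (hsum (1 / 2) (by norm_num) (by norm_num)).summable.norm
      refine this.congr fun n ↦ ?_
      simp [q]
  have hq := (q.hasFPowerSeriesOnBall hr).hasFPowerSeriesAt
  have hzero : ∃ᶠ t in nhdsWithin (0 : ℂ) {0}ᶜ, q.sum t = 0 := by
    refine Filter.Eventually.frequently ?_
    have hball : ∀ᶠ t in nhdsWithin (0 : ℂ) {0}ᶜ, ‖t‖ < 1 :=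
      nhdsWithin_le_nhds (by
        simpa [Metric.ball, Set.mem_ofPred] using Metric.ball_mem_nhds (0 : ℂ) one_pos)
    filter_upwards [hball, self_mem_nhdsWithin] with t ht1 ht0
    have := FormalMultilinearSeries.ofScalars_sum_eq (E := ℂ) c t
    simp only [smul_eq_mul] at this
    exact this.trans (hsum t ht0 ht1).tsum_eq
  have hq0 := hq.eq_zero_of_eventually (hq.analyticAt.frequently_zero_iff_eventually_zero.mp hzero)
  rw [FormalMultilinearSeries.ofScalars_series_eq_zero] at hq0
  ext n
  have := congrFun hq0 n
  simpa [hc] using this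

end QExpansion

section Eisenstein

open scoped ArithmeticFunction.sigma

/-- The generating series of the divisor power sums `σ k`. -/
def sigmaSeries (k : ℕ) : PowerSeries ℤ := PowerSeries.mk fun n ↦ (σ k n : ℤ)

/-- The integral `q`-expansion of the normalised Eisenstein series of weight four. -/
def eisFour : PowerSeries ℤ := 1 + 240 * sigmaSeries 3

/-- The integral `q`-expansion of the normalised Eisenstein series of weight six. -/
def eisSix : PowerSeries ℤ := 1 - 504 * sigmaSeries 5

theorem isQSeries_sigmaSeries (k : ℕ) :
    IsQSeries (sigmaSeries k)
      (fun w ↦ ∑' n : ℕ+, (σ k n : ℂ) * cexp (2 * Real.pi * I * w) ^ (n : ℕ)) := fun w hw ↦ by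
  have h := EisensteinSeries.summable_sigma_mul_cexp_pow (k := k + 1) (by lia) ⟨w, hw⟩
  have h2 := tsum_zero_pnat_eq_tsum_nat h
  simp only [Nat.add_sub_cancel, ArithmeticFunction.map_zero, Nat.cast_zero, zero_mul,
    zero_add] at h h2
  beta_reduce
  rw [h2]
  simpa [sigmaSeries] using h.hasSum

theorem tsum_lattice_eq {k : ℕ} (hk : 3 ≤ k) (hk2 : Even k) {w : ℂ} (hw : 0 < w.im) :
    ∑' v : {v : ℤ × ℤ // v ≠ 0}, ((v.1.1 : ℂ) * w + (v.1.2 : ℂ)) ^ (-k : ℤ) =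
      2 * riemannZeta k + 2 * ((-2 * Real.pi * I) ^ k / (k - 1).factorial) *
        ∑' n : ℕ+, (σ (k - 1) n : ℂ) * cexp (2 * Real.pi * I * w) ^ (n : ℕ) := by
  have h := tsum_eisSummand_eq_tsum_sigma_mul_cexp_pow hk hk2 ⟨w, hw⟩
  rw [← h, ← (finTwoArrowEquiv ℤ).symm.tsum_eq]
  have hk0 : k ≠ 0 := by lia
  exact tsum_subtype_eq_of_support_subset
    (f := fun v : ℤ × ℤ ↦ ((v.1 : ℂ) * w + (v.2 : ℂ)) ^ (-k : ℤ)) (s := {v | v ≠ 0})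
    fun v hv hv0 ↦ hv (by simp [hv0, hk0])

theorem riemannZeta_six : riemannZeta 6 = Real.pi ^ 6 / 945 := by
  have hb : _root_.bernoulli 6 = 1 / 42 := by
    rw [bernoulli_eq_bernoulli'_of_ne_one (by norm_num : (6 : ℕ) ≠ 1), bernoulli'_def]
    have h5 : bernoulli' 5 = 0 := bernoulli'_eq_zero_of_odd (by decide) (by norm_num)
    norm_num [Finset.sum_range_succ, Nat.choose, h5]
  have h := riemannZeta_two_mul_nat (k := 3) (by norm_num)
  norm_num [hb, Nat.factorial] at h
  rw [h]
  ring

theorem isQSeries_g2C :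
    IsQSeries eisFour (fun w ↦ (4 * Real.pi ^ 4 / 3 : ℂ)⁻¹ * g2C w) := by
  refine ((isQSeries_C (1 : ℤ)).add ((isQSeries_C (240 : ℤ)).mul (isQSeries_sigmaSeries 3))).congr
    fun w hw ↦ ?_
  have hpi : (Real.pi : ℂ) ≠ 0 := mod_cast Real.pi_ne_zero
  have h := tsum_lattice_eq (k := 4) (by norm_num) (by decide) hw
  have hI : (-2 * Real.pi * I : ℂ) ^ 4 = 16 * Real.pi ^ 4 := by
    rw [mul_pow, I_pow_four]; ring
  rw [hI, Nat.cast_ofNat, Nat.cast_ofNat, riemannZeta_four] at h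
  rw [g2C, h]
  simp [Nat.factorial]
  field_simp
  ring

theorem isQSeries_g3C :
    IsQSeries eisSix (fun w ↦ (8 * Real.pi ^ 6 / 27 : ℂ)⁻¹ * g3C w) := by
  refine ((isQSeries_C (1 : ℤ)).sub ((isQSeries_C (504 : ℤ)).mul (isQSeries_sigmaSeries 5))).congr
    fun w hw ↦ ?_
  have hpi : (Real.pi : ℂ) ≠ 0 := mod_cast Real.pi_ne_zero
  have h := tsum_lattice_eq (k := 6) (by norm_num) (by decide) hw
  have hI : (-2 * Real.pi * I : ℂ) ^ 6 = -64 * Real.pi ^ 6 := by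
    rw [mul_pow, show I ^ 6 = I ^ 4 * I ^ 2 by ring, I_pow_four, I_sq]; ring
  rw [hI, Nat.cast_ofNat, Nat.cast_ofNat, riemannZeta_six] at h
  rw [g3C, h]
  simp [Nat.factorial]
  field_simp
  ring

theorem jC_eq (w : ℂ) :
    jC w = 1728 * ((4 * Real.pi ^ 4 / 3 : ℂ)⁻¹ * g2C w) ^ 3 /
      (((4 * Real.pi ^ 4 / 3 : ℂ)⁻¹ * g2C w) ^ 3 - ((8 * Real.pi ^ 6 / 27 : ℂ)⁻¹ * g3C w) ^ 2) := by
  have hpi : (Real.pi : ℂ) ≠ 0 := mod_cast Real.pi_ne_zero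
  have hc : (27 / (64 * Real.pi ^ 12) : ℂ) ≠ 0 :=
    div_ne_zero (by norm_num) (mul_ne_zero (by norm_num) (pow_ne_zero _ hpi))
  rw [jC, discC, ← mul_div_mul_left _ _ hc]
  congr 1 <;> field_simp <;> ring

theorem twelve_dvd_sigma (n : ℕ) : (12 : ℤ) ∣ 5 * σ 3 n + 7 * σ 5 n := by
  rw [ArithmeticFunction.sigma_apply, ArithmeticFunction.sigma_apply]
  push_cast
  rw [Finset.mul_sum, Finset.mul_sum, ← Finset.sum_add_distrib]
  refine Finset.dvd_sum fun d _ ↦ ?_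
  have h : ∀ x : ZMod 12, 5 * x ^ 3 + 7 * x ^ 5 = 0 := by decide
  refine (ZMod.intCast_zmod_eq_zero_iff_dvd _ 12).mp ?_
  exact_mod_cast h d

theorem exists_discriminant_series :
    ∃ U : PowerSeries ℤ, PowerSeries.constantCoeff U = 1 ∧
      eisFour ^ 3 - eisSix ^ 2 = 1728 * (PowerSeries.X * U) := by
  choose t ht using twelve_dvd_sigma
  have hT : 5 * sigmaSeries 3 + 7 * sigmaSeries 5 = 12 * PowerSeries.mk t := by
    ext n
    rw [← map_ofNat (PowerSeries.C (R := ℤ)) 5, ← map_ofNat (PowerSeries.C (R := ℤ)) 7,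
      ← map_ofNat (PowerSeries.C (R := ℤ)) 12]
    simp only [map_add, PowerSeries.coeff_C_mul, sigmaSeries, PowerSeries.coeff_mk, ht n]
  have ht0 : t 0 = 0 := by simpa using ht 0
  have ht1 : t 1 = 1 := by simpa using ht 1
  have hX (P : PowerSeries ℤ) (hP : PowerSeries.constantCoeff P = 0) :
      ∃ Q, P = PowerSeries.X * Q := PowerSeries.X_dvd_iff.mpr hP
  obtain ⟨a, ha⟩ := hX (sigmaSeries 3) (by simp [sigmaSeries])
  obtain ⟨b, hb⟩ := hX (sigmaSeries 5) (by simp [sigmaSeries])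
  obtain ⟨c, hc⟩ := hX (PowerSeries.mk t) (by simp [ht0])
  have hc1 : PowerSeries.constantCoeff c = 1 := by
    have := congrArg (PowerSeries.coeff 1) hc
    rw [PowerSeries.coeff_mk, ht1, PowerSeries.coeff_succ_X_mul 0] at this
    simpa using this.symm
  refine ⟨c + PowerSeries.X * (100 * a ^ 2 + 8000 * PowerSeries.X * a ^ 3 - 147 * b ^ 2),
    by simp [hc1], ?_⟩
  rw [hc, ha, hb] at hT
  rw [eisFour, eisSix, ha, hb]
  linear_combination 144 * hT

end Eisenstein

theorem map_sub_prod_X_sub_C {S T ι : Type*} [CommRing S] [CommRing T] [Fintype ι]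
    (J : Polynomial (Polynomial ℤ)) (y : S) (x : ι → S) (θ : S →+* T) :
    (J.map (eval₂RingHom (Int.castRingHom S) y) -
      ∏ i, (Polynomial.X - Polynomial.C (x i))).map θ =
    J.map (eval₂RingHom (Int.castRingHom T) (θ y)) -
      ∏ i, (Polynomial.X - Polynomial.C (θ (x i))) := by
  simp only [Polynomial.map_sub, Polynomial.map_prod, Polynomial.map_map, Polynomial.map_X,
    Polynomial.map_C]
  congr 2
  ext <;> simp

section Laurent

variable {A B : Type*} [CommRing A] [Algebra A ℂ] [CommRing B]
  [Algebra (PowerSeries A) B]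

/-- `L` is a quotient of two `q`-series, and `f` is the quotient of the corresponding functions. -/
def IsQuotientQSeries (f : ℂ → ℂ) (L : B) : Prop :=
  ∃ (P Q : PowerSeries A) (g h : ℂ → ℂ), IsQSeries P g ∧ IsQSeries Q h ∧ P ≠ 0 ∧
    (∀ w : ℂ, 0 < w.im → g w * f w = h w) ∧
    algebraMap (PowerSeries A) B P * L = algebraMap (PowerSeries A) B Q

theorem IsQuotientQSeries.eq_zero [IsDomain B] [FaithfulSMul (PowerSeries A) B]
    [FaithfulSMul A ℂ] {f : ℂ → ℂ} {L : B} (hf : IsQuotientQSeries (A := A) f L)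
    (h0 : ∀ w : ℂ, 0 < w.im → f w = 0) : L = 0 := by
  obtain ⟨P, Q, g, h, -, hQ, hP0, hfw, hL⟩ := hf
  have hQ0 : Q = 0 := hQ.eq_zero fun w hw ↦ by rw [← hfw w hw, h0 w hw, mul_zero]
  rw [hQ0, map_zero] at hL
  exact (mul_eq_zero.mp hL).resolve_left fun hP ↦
    hP0 ((map_eq_zero_iff _ (FaithfulSMul.algebraMap_injective _ _)).mp hP)

variable [IsDomain A]

variable (A B) in
/-- The ring of pairs of a function and a quotient of `q`-series representing it. -/
def quotientQSeriesSubring : Subring ((ℂ → ℂ) × B) where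
  carrier := {x | IsQuotientQSeries (A := A) x.1 x.2}
  mul_mem' := by
    rintro ⟨f, L⟩ ⟨f', L'⟩ ⟨P, Q, g, h, hP, hQ, hP0, hf, hL⟩
      ⟨P', Q', g', h', hP', hQ', hP0', hf', hL'⟩
    refine ⟨P * P', Q * Q', g * g', h * h', hP.mul hP', hQ.mul hQ', mul_ne_zero hP0 hP0',
      fun w hw ↦ ?_, ?_⟩
    · simp only [Prod.mk_mul_mk, Pi.mul_apply, ← hf w hw, ← hf' w hw]
      ring
    · simp only [Prod.mk_mul_mk, map_mul, ← hL, ← hL']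
      ring
  one_mem' := ⟨1, 1, 1, 1, (qSeriesSubring A).one_mem, (qSeriesSubring A).one_mem, one_ne_zero,
    fun _ _ ↦ by simp, by simp⟩
  add_mem' := by
    rintro ⟨f, L⟩ ⟨f', L'⟩ ⟨P, Q, g, h, hP, hQ, hP0, hf, hL⟩
      ⟨P', Q', g', h', hP', hQ', hP0', hf', hL'⟩
    refine ⟨P * P', P' * Q + P * Q', g * g', g' * h + g * h', hP.mul hP',
      (hP'.mul hQ).add (hP.mul hQ'), mul_ne_zero hP0 hP0', fun w hw ↦ ?_, ?_⟩
    · simp only [Prod.mk_add_mk, Pi.mul_apply, Pi.add_apply, ← hf w hw, ← hf' w hw]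
      ring
    · simp only [Prod.mk_add_mk, map_mul, map_add, ← hL, ← hL']
      ring
  zero_mem' := ⟨1, 0, 1, 0, (qSeriesSubring A).one_mem, (qSeriesSubring A).zero_mem, one_ne_zero,
    fun _ _ ↦ by simp, by simp⟩
  neg_mem' := by
    rintro ⟨f, L⟩ ⟨P, Q, g, h, hP, hQ, hP0, hf, hL⟩
    exact ⟨P, -Q, g, -h, hP, (qSeriesSubring A).neg_mem (x := (h, Q)) hQ, hP0,
      fun w hw ↦ by simp [hf w hw], by simp [hL]⟩

/-- The expansion of `j ∘ τ` from the expansions of the Eisenstein series composed with `τ`. -/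
theorem isQuotientQSeries_jC (φ : PowerSeries ℤ →+* PowerSeries A) {τ : ℂ → ℂ}
    (h4 : IsQSeries (φ eisFour) (fun w ↦ (4 * Real.pi ^ 4 / 3 : ℂ)⁻¹ * g2C (τ w)))
    (h6 : IsQSeries (φ eisSix) (fun w ↦ (8 * Real.pi ^ 6 / 27 : ℂ)⁻¹ * g3C (τ w)))
    {D : PowerSeries ℤ} (hD : eisFour ^ 3 - eisSix ^ 2 = 1728 * D) (hne : φ (1728 * D) ≠ 0) {y : B}
    (hy : algebraMap (PowerSeries A) B (φ D) * y = algebraMap (PowerSeries A) B (φ (eisFour ^ 3))) :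
    IsQuotientQSeries (A := A) (fun w ↦ jC (τ w)) y := by
  have h1728 : IsQSeries (1728 : PowerSeries A) (1728 : ℂ → ℂ) :=
    ofNat_mem (qSeriesSubring A) 1728
  have hd := (h4.pow 3).sub (h6.pow 2)
  rw [← map_pow, ← map_pow, ← map_sub, hD] at hd
  refine ⟨φ (1728 * D) ^ 2, 1728 * φ eisFour ^ 3 * φ (1728 * D), _, _, hd.pow 2,
    (h1728.mul (h4.pow 3)).mul hd, pow_ne_zero 2 hne, fun w _ ↦ ?_, ?_⟩
  · simp only [Pi.pow_apply, Pi.sub_apply, Pi.mul_apply, Pi.ofNat_apply, jC_eq (τ w)]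
    rcases eq_or_ne ((((4 * Real.pi ^ 4 / 3 : ℂ)⁻¹ * g2C (τ w)) ^ 3 -
      ((8 * Real.pi ^ 6 / 27 : ℂ)⁻¹ * g3C (τ w)) ^ 2)) 0 with h0 | h0
    · rw [h0]; simp
    · field_simp
  · simp only [map_pow, map_mul, map_ofNat] at hy ⊢
    linear_combination 1728 ^ 2 * (algebraMap (PowerSeries A) B (φ D)) * hy

variable [IsDomain B] [FaithfulSMul (PowerSeries A) B]

/-- A factorisation of a polynomial over `ℤ[Y]` that holds on the upper half-plane also holds
for the corresponding quotients of `q`-series. -/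
theorem map_eq_prod_of_isQuotientQSeries [FaithfulSMul A ℂ] {ι : Type*} [Fintype ι]
    (J : Polynomial (Polynomial ℤ)) {y : ℂ → ℂ} {Y : B} (hy : IsQuotientQSeries (A := A) y Y)
    {x : ι → ℂ → ℂ} {Z : ι → B} (hx : ∀ i, IsQuotientQSeries (A := A) (x i) (Z i))
    (h : ∀ w : ℂ, 0 < w.im → J.map (eval₂RingHom (Int.castRingHom ℂ) (y w)) =
      ∏ i, (Polynomial.X - Polynomial.C (x i w))) :
    J.map (eval₂RingHom (Int.castRingHom B) Y) =
      ∏ i, (Polynomial.X - Polynomial.C (Z i)) := by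
  let S := quotientQSeriesSubring A B
  let yS : S := ⟨(y, Y), hy⟩
  let xS (i : ι) : S := ⟨(x i, Z i), hx i⟩
  let series : S →+* B := (RingHom.snd _ _).comp S.subtype
  let value (w : ℂ) : S →+* ℂ := (Pi.evalRingHom _ w).comp ((RingHom.fst _ _).comp S.subtype)
  let q : Polynomial S := J.map (eval₂RingHom (Int.castRingHom S) yS) -
    ∏ i, (Polynomial.X - Polynomial.C (xS i))
  have hvalue (w : ℂ) (hw : 0 < w.im) : q.map (value w) = 0 := by
    rw [map_sub_prod_X_sub_C, sub_eq_zero]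
    exact h w hw
  have hseries : q.map series = 0 := by
    ext i
    rw [Polynomial.coeff_map, Polynomial.coeff_zero]
    refine IsQuotientQSeries.eq_zero (q.coeff i).2 fun w hw ↦ ?_
    have := congrArg (fun r ↦ Polynomial.coeff r i) (hvalue w hw)
    rwa [Polynomial.coeff_map] at this
  rw [map_sub_prod_X_sub_C, sub_eq_zero] at hseries
  exact hseries

end Laurent

section OrbitReps

variable {p : ℕ}

theorem psi_prime (hp : p.Prime) : psi p = p + 1 := by
  rw [psi, hp.sum_divisors]
  simp [hp.prime.squarefree, Nat.div_self hp.pos, add_comm]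

variable (p) in
/-- The standard representatives of the primitive matrices of prime determinant. -/
def primeReps : Fin (p + 1) → Mat :=
  Fin.cons !![(p : ℤ), 0; 0, 1] fun b : Fin p ↦ !![1, (b : ℤ); 0, (p : ℤ)]

theorem leftEquiv_upper_iff (hp : p ≠ 0) {T : Mat} (hT : T.det = p) (b : ℤ) :
    LeftEquiv T !![1, b; 0, (p : ℤ)] ↔
      (p : ℤ) ∣ T 0 1 - T 0 0 * b ∧ (p : ℤ) ∣ T 1 1 - T 1 0 * b := by
  have hp' : (p : ℤ) ≠ 0 := mod_cast hp
  constructor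
  · rintro ⟨M, rfl⟩
    simp [Matrix.mul_apply, Fin.sum_univ_two]
  · rintro ⟨⟨x, hx⟩, ⟨y, hy⟩⟩
    rw [Matrix.det_fin_two] at hT
    refine ⟨⟨!![T 0 0, x; T 1 0, y], ?_⟩, ?_⟩
    · rw [Matrix.det_fin_two_of]
      refine mul_left_cancel₀ hp' ?_
      linear_combination hT + T 1 0 * hx - T 0 0 * hy
    · ext i j
      fin_cases i <;> fin_cases j <;> simp [Matrix.mul_apply, Fin.sum_univ_two]
      · linear_combination hx
      · linear_combination hy

theorem leftEquiv_diagonal_iff (hp : p ≠ 0) {T : Mat} (hT : T.det = p) :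
    LeftEquiv T !![(p : ℤ), 0; 0, 1] ↔ (p : ℤ) ∣ T 0 0 ∧ (p : ℤ) ∣ T 1 0 := by
  have hp' : (p : ℤ) ≠ 0 := mod_cast hp
  constructor
  · rintro ⟨M, rfl⟩
    simp [Matrix.mul_apply, Fin.sum_univ_two]
  · rintro ⟨⟨x, hx⟩, ⟨y, hy⟩⟩
    rw [Matrix.det_fin_two] at hT
    refine ⟨⟨!![x, T 0 1; y, T 1 1], ?_⟩, ?_⟩
    · rw [Matrix.det_fin_two_of]
      refine mul_left_cancel₀ hp' ?_
      linear_combination hT - T 1 1 * hx + T 0 1 * hy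
    · ext i j
      fin_cases i <;> fin_cases j <;> simp [Matrix.mul_apply, Fin.sum_univ_two]
      · linear_combination hx
      · linear_combination hy

theorem isOrbitReps_primeReps (hp : p.Prime) : IsOrbitReps p (primeReps p) := by
  have := Fact.mk hp
  have hp0 := hp.ne_zero
  refine ⟨fun ν ↦ ?_, fun T _ hT ↦ ?_⟩
  · refine Fin.cases ?_ (fun b ↦ ?_) ν <;>
      simp [primeReps, Mat.IsPrimitive, Matrix.det_fin_two]
  · have hpos := leftEquiv_upper_iff hp0 hT
    have hdet : (T 0 0 : ZMod p) * T 1 1 - T 0 1 * T 1 0 = 0 := by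
      have := congrArg (Int.cast : ℤ → ZMod p) hT
      rw [Matrix.det_fin_two] at this
      simpa using this
    have hupper (b : Fin p) : LeftEquiv T (primeReps p b.succ) ↔
        (T 0 1 : ZMod p) = T 0 0 * b ∧ (T 1 1 : ZMod p) = T 1 0 * b := by
      simp only [primeReps, Fin.cons_succ]
      rw [hpos, ← ZMod.intCast_zmod_eq_zero_iff_dvd, ← ZMod.intCast_zmod_eq_zero_iff_dvd]
      simp [sub_eq_zero]
    have hdiag : LeftEquiv T (primeReps p 0) ↔ (T 0 0 : ZMod p) = 0 ∧ (T 1 0 : ZMod p) = 0 := by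
      simp only [primeReps, Fin.cons_zero]
      rw [leftEquiv_diagonal_iff hp0 hT, ZMod.intCast_zmod_eq_zero_iff_dvd,
        ZMod.intCast_zmod_eq_zero_iff_dvd]
    by_cases h0 : (T 0 0 : ZMod p) = 0 ∧ (T 1 0 : ZMod p) = 0
    · refine ⟨0, hdiag.mpr h0, Fin.cases (fun _ ↦ rfl) fun b hb ↦ ?_⟩
      obtain ⟨h1, h2⟩ := (hupper b).mp hb
      rw [h0.1, zero_mul, ZMod.intCast_zmod_eq_zero_iff_dvd] at h1
      rw [h0.2, zero_mul, ZMod.intCast_zmod_eq_zero_iff_dvd] at h2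
      obtain ⟨x, hx⟩ := (ZMod.intCast_zmod_eq_zero_iff_dvd _ _).mp h0.1
      obtain ⟨y, hy⟩ := (ZMod.intCast_zmod_eq_zero_iff_dvd _ _).mp h0.2
      obtain ⟨z, hz⟩ := h1
      obtain ⟨t, ht⟩ := h2
      rw [Matrix.det_fin_two, hx, hy, hz, ht] at hT
      have hdvd : (p : ℤ) ∣ 1 := ⟨x * t - z * y, mul_left_cancel₀ (Nat.cast_ne_zero.mpr hp0)
        (by linear_combination -hT)⟩
      exact absurd (Int.natCast_dvd_natCast.mp (mod_cast hdvd : (p : ℤ) ∣ (1 : ℕ))) hp.not_dvd_one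
    · obtain ⟨β, h1, h2⟩ : ∃ β : ZMod p, (T 0 1 : ZMod p) = T 0 0 * β ∧
          (T 1 1 : ZMod p) = T 1 0 * β := by
        by_cases ha : (T 0 0 : ZMod p) = 0
        · have hc : (T 1 0 : ZMod p) ≠ 0 := fun hc ↦ h0 ⟨ha, hc⟩
          refine ⟨T 1 1 / T 1 0, ?_, by field_simp⟩
          rw [ha, zero_mul, zero_sub, neg_eq_zero] at hdet
          rw [ha, zero_mul, (mul_eq_zero.mp hdet).resolve_right hc]
        · refine ⟨T 0 1 / T 0 0, by field_simp, ?_⟩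
          field_simp
          linear_combination hdet
      refine ⟨(⟨β.val, ZMod.val_lt β⟩ : Fin p).succ, (hupper _).mpr ?_, fun ν ↦ ?_⟩
      · simpa using ⟨h1, h2⟩
      · refine Fin.cases (fun h ↦ absurd (hdiag.mp h) h0) (fun b hb ↦ ?_) ν
        obtain ⟨h3, h4⟩ := (hupper b).mp hb
        have hβ : ((b : ℕ) : ZMod p) = β := by
          by_contra hne
          refine h0 ⟨?_, ?_⟩
          · exact (mul_eq_mul_left_iff.mp (h3.symm.trans h1)).resolve_left hne
          · exact (mul_eq_mul_left_iff.mp (h4.symm.trans h2)).resolve_left hne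
        congr 1
        ext
        simp [← hβ, ZMod.val_natCast, Nat.mod_eq_of_lt b.2]

/-- The defining factorisation of the modular polynomial of prime level. -/
theorem IsModularPoly.map_eq_prod_primeReps (hp : p.Prime) {J : Polynomial (Polynomial ℤ)}
    (hJ : IsModularPoly p J) {z : ℂ} (hz : 0 < z.im) :
    J.map (evalAtJ z) =
      ∏ ν, (Polynomial.X - Polynomial.C (jC (moeb (primeReps p ν) z))) := by
  have h := hJ.2.2
  rw [psi_prime hp] at h
  exact h _ (isOrbitReps_primeReps hp) z hz

end OrbitReps

section Reduction

theorem dvd_coeff_of_map_eq_zero {p : ℕ} {k K : Type*} [Field k] [CharP k p] [Field K] [Algebra k K]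
    {x : K} (hx : Transcendental k x) {G : Polynomial (Polynomial ℤ)}
    (hG : G.map (eval₂RingHom (Int.castRingHom K) x) = 0) (i n : ℕ) :
    (p : ℤ) ∣ (G.coeff i).coeff n := by
  have h := congrArg (fun r ↦ Polynomial.coeff r i) hG
  simp only [Polynomial.coeff_map, Polynomial.coeff_zero, coe_eval₂RingHom] at h
  have hz : (G.coeff i).map (Int.castRingHom k) = 0 := by
    by_contra hne
    refine hx ⟨_, hne, ?_⟩
    rw [Polynomial.aeval_def, Polynomial.eval₂_map]
    rwa [RingHom.ext_int ((algebraMap k K).comp (Int.castRingHom k)) (Int.castRingHom K)]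
  rw [← CharP.intCast_eq_zero_iff k p]
  simpa using congrArg (fun r ↦ Polynomial.coeff r n) hz

theorem transcendental_of_constantCoeff_eq_zero {k : Type*} [Field k] {v : PowerSeries k}
    (h0 : PowerSeries.constantCoeff v = 0) (hv : v ≠ 0) : Transcendental k v := by
  intro hv'
  have hc := minpoly.coeff_zero_ne_zero hv'.isIntegral hv
  have h := congrArg PowerSeries.constantCoeff (minpoly.aeval k v)
  rw [Polynomial.aeval_def, Polynomial.hom_eval₂, h0, Polynomial.eval₂_at_zero] at h
  exact hc (by simpa using h)

theorem transcendental_of_mul_eq_one {k : Type*} [Field k] {v : PowerSeries k}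
    (h0 : PowerSeries.constantCoeff v = 0) {x : FractionRing (PowerSeries k)}
    (hx : x * algebraMap (PowerSeries k) _ v = 1) : Transcendental k x := by
  intro halg
  have hv : v ≠ 0 := by
    rintro rfl
    simp at hx
  have := halg.inv
  rw [inv_eq_of_mul_eq_one_right hx] at this
  exact transcendental_of_constantCoeff_eq_zero h0 hv
    ((isAlgebraic_algebraMap_iff (IsFractionRing.injective _ _)).mp this)

theorem expand_map_intCast {p : ℕ} (hp : p.Prime) {k : Type*} [CommRing k] [CharP k p]
    (P : PowerSeries ℤ) : (P.map (Int.castRingHom k)).expand p hp.ne_zero =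
      P.map (Int.castRingHom k) ^ p := by
  have := ExpChar.prime (R := k) hp
  have h := MvPowerSeries.map_frobenius_expand (σ := Unit) p hp.ne_zero
    (f := P.map (Int.castRingHom k))
  rw [← h]
  have hcast : (frobenius k p).comp (Int.castRingHom k) = Int.castRingHom k := RingHom.ext_int _ _
  change _ = PowerSeries.map (frobenius k p) (PowerSeries.expand p hp.ne_zero _)
  rw [PowerSeries.map_expand, ← RingHom.comp_apply, ← PowerSeries.map_comp, hcast]

theorem exists_residueField {p : ℕ} (hp : p.Prime) :
    ∃ (k : Type) (_ : Field k) (_ : integralClosure ℤ ℂ →+* k), CharP k p := by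
  have hmax : (Ideal.span {(p : ℤ)}).IsMaximal :=
    PrincipalIdealRing.isMaximal_of_irreducible (Nat.prime_iff_prime_int.mp hp).irreducible
  obtain ⟨m, hm, hlies⟩ := Ideal.exists_maximal_ideal_liesOver_of_isIntegral
    (S := integralClosure ℤ ℂ) (Ideal.span {(p : ℤ)})
  let _ := Ideal.Quotient.field m
  refine ⟨_ ⧸ m, inferInstance, Ideal.Quotient.mk m, ?_⟩
  rw [CharP.charP_iff_prime_eq_zero hp, ← map_natCast (Ideal.Quotient.mk m),
    Ideal.Quotient.eq_zero_iff_mem]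
  have : (p : ℤ) ∈ m.under ℤ := hlies.over ▸ Ideal.mem_span_singleton_self _
  simpa using this

theorem kronecker_congruence {A k : Type*} [CommRing A] [IsDomain A] [Algebra A ℂ]
    [FaithfulSMul A ℂ] [Field k] {p : ℕ} [CharP k p] (hp : p.Prime) (π : A →+* k) {ζ : A}
    (hζ : algebraMap A ℂ ζ = cexp (2 * Real.pi * I / p)) {J : Polynomial (Polynomial ℤ)}
    (hJ : IsModularPoly p J) (i n : ℕ) :
    (p : ℤ) ∣
      (((J - ((Polynomial.X : Polynomial (Polynomial ℤ)) ^ p - C Polynomial.X) *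
        ((Polynomial.X : Polynomial (Polynomial ℤ)) - C (Polynomial.X ^ p))).coeff i).coeff n) := by
  have := Fact.mk hp
  obtain ⟨U, hU, hD⟩ := exists_discriminant_series
  let B := Localization.Away (PowerSeries.X : PowerSeries A)
  let K := FractionRing (PowerSeries k)
  have hle : Submonoid.powers (PowerSeries.X : PowerSeries A) ≤ nonZeroDivisors _ :=
    powers_le_nonZeroDivisors_of_noZeroDivisors PowerSeries.X_ne_zero
  have : IsDomain B := IsLocalization.isDomain_localization hle
  have : FaithfulSMul (PowerSeries A) B :=
    (faithfulSMul_iff_algebraMap_injective _ _).mpr (IsLocalization.injective B hle)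
  have hXB : IsUnit (algebraMap (PowerSeries A) B PowerSeries.X) :=
    IsLocalization.Away.algebraMap_isUnit _
  have hXk : algebraMap (PowerSeries k) K PowerSeries.X ≠ 0 :=
    (map_ne_zero_iff _ (IsFractionRing.injective _ K)).mpr PowerSeries.X_ne_zero
  have hXK : IsUnit (((algebraMap (PowerSeries k) K).comp (PowerSeries.map π)) PowerSeries.X) := by
    simpa only [RingHom.comp_apply, PowerSeries.map_X] using hXk.isUnit
  let ρ : B →+* K := IsLocalization.Away.lift PowerSeries.X hXK
  have hρ (P : PowerSeries A) :
      ρ (algebraMap _ B P) = algebraMap _ K (P.map π) := IsLocalization.Away.lift_eq _ hXK P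
  have hUunit : IsUnit U := PowerSeries.isUnit_iff_constantCoeff.mpr (by simp [hU])
  let α : PowerSeries ℤ →+* K :=
    (algebraMap (PowerSeries k) K).comp (PowerSeries.map (Int.castRingHom k))
  have hαD : α (PowerSeries.X * U) ≠ 0 := by
    rw [map_mul]
    exact mul_ne_zero (by simp [α]) (hUunit.map α).ne_zero
  let j₀ : K := α (eisFour ^ 3) / α (PowerSeries.X * U)
  have h1728 : (1728 : PowerSeries A) ≠ 0 := fun h ↦ by
    have := congrArg ((algebraMap A ℂ).comp PowerSeries.constantCoeff) h
    rw [map_ofNat, map_zero] at this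
    norm_num at this
  have key (φ : PowerSeries ℤ →+* PowerSeries A) (τ : ℂ → ℂ)
      (hφ : ∀ P f, IsQSeries P f → IsQSeries (φ P) (fun w ↦ f (τ w)))
      (hX : IsUnit (algebraMap _ B (φ PowerSeries.X))) (e : ℕ)
      (he : ∀ P, (φ P).map π = P.map (Int.castRingHom k) ^ e) :
      ∃ y : B, IsQuotientQSeries (A := A) (fun w ↦ jC (τ w)) y ∧ ρ y = j₀ ^ e := by
    have hunit : IsUnit (algebraMap _ B (φ (PowerSeries.X * U))) := by
      rw [map_mul, map_mul]
      exact hX.mul ((hUunit.map φ).map _)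
    obtain ⟨u, hu⟩ := hunit
    have hy : algebraMap _ B (φ (PowerSeries.X * U)) *
        (↑u⁻¹ * algebraMap _ B (φ (eisFour ^ 3))) = algebraMap _ B (φ (eisFour ^ 3)) := by
      rw [← hu, Units.mul_inv_cancel_left]
    refine ⟨_, isQuotientQSeries_jC φ (hφ _ _ isQSeries_g2C) (hφ _ _ isQSeries_g3C) hD ?_ hy, ?_⟩
    · rw [map_mul, map_ofNat]
      refine mul_ne_zero h1728 fun h0 ↦ ?_
      rw [h0, map_zero] at hu
      exact u.ne_zero hu
    · have := congrArg ρ hy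
      rw [map_mul ρ, hρ, hρ, he, he, map_pow (algebraMap _ K), map_pow (algebraMap _ K)] at this
      rw [div_pow, eq_div_iff (pow_ne_zero _ hαD), mul_comm]
      exact this
  have hexpand (m : ℕ) (hm : m ≠ 0) : ∃ φ : PowerSeries ℤ →+* PowerSeries A,
      (∀ P, φ P = (P.map (Int.castRingHom A)).expand m hm) ∧
      (∀ P f, IsQSeries P f → IsQSeries (φ P) (fun w ↦ f (m * w))) ∧
      IsUnit (algebraMap _ B (φ PowerSeries.X)) :=
    ⟨(PowerSeries.expand m hm).toRingHom.comp (PowerSeries.map (Int.castRingHom A)),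
      fun _ ↦ rfl, fun _ _ hf ↦ hf.map_int.expand m hm, by simpa using hXB.pow m⟩
  have hcomp : π.comp (Int.castRingHom A) = Int.castRingHom k := RingHom.ext_int _ _
  obtain ⟨Y, hY, hρY⟩ : ∃ y : B, IsQuotientQSeries (A := A) (fun w ↦ jC (p * w)) y ∧
      ρ y = j₀ ^ p := by
    obtain ⟨φ, h1, h2, h3⟩ := hexpand p hp.ne_zero
    refine key φ (fun w ↦ p * w) h2 h3 p fun P ↦ ?_
    rw [h1, PowerSeries.map_expand, ← RingHom.comp_apply, ← PowerSeries.map_comp, hcomp,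
      expand_map_intCast hp]
  obtain ⟨Z, hZ, hρZ⟩ : ∃ y : B,
      IsQuotientQSeries (A := A) (fun w ↦ jC ((p * p : ℕ) * w)) y ∧ ρ y = j₀ ^ (p * p) := by
    obtain ⟨φ, h1, h2, h3⟩ := hexpand (p * p) (mul_ne_zero hp.ne_zero hp.ne_zero)
    refine key φ (fun w ↦ (p * p : ℕ) * w) h2 h3 (p * p) fun P ↦ ?_
    rw [h1, PowerSeries.map_expand, ← RingHom.comp_apply, ← PowerSeries.map_comp, hcomp,
      PowerSeries.expand_mul p hp.ne_zero p hp.ne_zero, expand_map_intCast hp, map_pow,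
      expand_map_intCast hp, pow_mul]
  have hζp : ζ ^ p = 1 := FaithfulSMul.algebraMap_injective A ℂ (by
    rw [map_pow, hζ, ← Complex.exp_nat_mul, mul_div_cancel₀ _ (mod_cast hp.ne_zero), map_one,
      Complex.exp_two_pi_mul_I])
  have hπζ : π ζ = 1 := by
    have : (π ζ - 1) ^ p = 0 := by
      rw [sub_pow_char, ← map_pow, hζp, map_one, one_pow, sub_self]
    exact sub_eq_zero.mp (pow_eq_zero_iff hp.ne_zero |>.mp this)
  have hshift (b : Fin p) : ∃ y : B,
      IsQuotientQSeries (A := A) (fun w ↦ jC (w + ((b / p : ℝ) : ℂ))) y ∧ ρ y = j₀ := by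
    have hunit : IsUnit (ζ ^ (b : ℕ)) := (IsUnit.of_pow_eq_one hζp hp.ne_zero).pow _
    have := key ((PowerSeries.rescale (ζ ^ (b : ℕ))).comp (PowerSeries.map (Int.castRingHom A)))
      (fun w ↦ w + ((b / p : ℝ) : ℂ)) (fun _ _ hf ↦ hf.map_int.rescale (b / p : ℝ) ?_) ?_ 1 ?_
    · simpa using this
    · rw [map_pow, hζ, ← Complex.exp_nat_mul]
      push_cast
      ring_nf
    · rw [RingHom.comp_apply, PowerSeries.map_X, PowerSeries.rescale_X, map_mul]
      exact ((hunit.map PowerSeries.C).map _).mul hXB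
    · intro P
      ext n
      simp [PowerSeries.coeff_rescale, hπζ]
  choose W hW hρW using hshift
  have hfac := map_eq_prod_of_isQuotientQSeries J hY
    (x := Fin.cons (fun w ↦ jC ((p * p : ℕ) * w)) fun b w ↦ jC (w + ((b / p : ℝ) : ℂ)))
    (Z := Fin.cons Z W) (Fin.cases hZ hW) fun w hw ↦ by
      have hpw : 0 < ((p : ℂ) * w).im := by
        simpa using mul_pos (mod_cast hp.pos : (0 : ℝ) < p) hw
      refine (hJ.map_eq_prod_primeReps hp hpw).trans (Finset.prod_congr rfl fun ν _ ↦ ?_)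
      congr 3
      refine Fin.cases ?_ (fun b ↦ ?_) ν
      · simp [primeReps, moeb, mul_assoc]
      · have : (p : ℂ) ≠ 0 := mod_cast hp.ne_zero
        simp [primeReps, moeb, add_div, this]
  have : CharP K p := charP_of_injective_ringHom
    (f := (algebraMap (PowerSeries k) K).comp PowerSeries.C) (RingHom.injective _) p
  have hJK : J.map (eval₂RingHom (Int.castRingHom K) (j₀ ^ p)) =
      (Polynomial.X ^ p - Polynomial.C (j₀ ^ p)) *
        (Polynomial.X - Polynomial.C ((j₀ ^ p) ^ p)) := by
    have h := congrArg (Polynomial.map ρ) hfac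
    rw [Polynomial.map_map, Polynomial.map_prod, Fin.prod_univ_succ] at h
    have hcomp : ρ.comp (eval₂RingHom (Int.castRingHom B) Y) =
        eval₂RingHom (Int.castRingHom K) (j₀ ^ p) := by
      ext <;> simp [hρY]
    simp only [Fin.cons_zero, Fin.cons_succ, Polynomial.map_sub, Polynomial.map_X,
      Polynomial.map_C, hρZ, hρW, Finset.prod_const, Finset.card_univ, Fintype.card_fin,
      sub_pow_char, hcomp] at h
    rw [h, pow_mul, ← Polynomial.C_pow, mul_comm]
  have hj : Transcendental k (j₀ ^ p) := by
    obtain ⟨V, hV⟩ : ∃ V, eisFour ^ 3 * V = 1 := by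
      refine (PowerSeries.isUnit_iff_constantCoeff.mpr ?_).exists_right_inv
      simp [eisFour, sigmaSeries]
    intro halg
    refine transcendental_of_mul_eq_one (x := j₀)
      (v := (PowerSeries.X * U * V).map (Int.castRingHom k)) (by simp) ?_ (halg.of_pow hp.pos)
    change j₀ * α (PowerSeries.X * U * V) = 1
    rw [map_mul, ← mul_assoc, div_mul_cancel₀ _ hαD, ← map_mul, hV, map_one]
  refine dvd_coeff_of_map_eq_zero hj ?_ i n
  simp [hJK]

end Reduction

/-- Kronecker congruence: for a prime p,
J_p(X,Y) ≡ (X^p − Y)·(X − Y^p) mod p, coefficientwise in ℤ[X,Y].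
(Here J is ℤ[Y][X]-valued: the inner `Polynomial.X` is the variable Y.) -/
theorem stmt3 (p : ℕ) (hp : p.Prime) (J : Polynomial (Polynomial ℤ))
    (hJ : IsModularPoly p J) :
    ∀ i k : ℕ, (p : ℤ) ∣
      (((J - ((Polynomial.X : Polynomial (Polynomial ℤ)) ^ p - C Polynomial.X) *
        ((Polynomial.X : Polynomial (Polynomial ℤ)) - C (Polynomial.X ^ p))).coeff i).coeff k) := by
  obtain ⟨k, _, π, _⟩ := exists_residueField hp
  have hp0 : (p : ℂ) ≠ 0 := mod_cast hp.ne_zero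
  have hpow : cexp (2 * Real.pi * I / p) ^ p = 1 := by
    rw [← Complex.exp_nat_mul, mul_div_cancel₀ _ hp0, Complex.exp_two_pi_mul_I]
  exact kronecker_congruence hp π
    (ζ := ⟨_, IsIntegral.of_pow hp.pos (hpow ▸ isIntegral_one)⟩) rfl hJ

end
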